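/- Let n be an integer and let f : ℍ → ℂ be a continuous, compactly supported function satisfying f(k_θ·z) = e^{2inθ}·f(z) for all θ ∈ ℝ and z ∈ ℍ. Then for every r ∈ ℝ, every z = x + iy ∈ ℍ and every α ∈ ℝ, the convolution operator L[f] applied to φ_r satisfies ∫_ℍ f((p_z k_α)^{−1}·w)·φ_r(w) dμ(w) = 𝒮_n f(r) · e^{−2inα} · exp((ir+1/2)·log y). -/

import Mathlib

open MeasureTheory Complex

noncomputable section

/-- Möbius action of a real 2×2 matrix on a complex number. -/
def moebius (g : Matrix (Fin 2) (Fin 2) ℝ) (z : ℂ) : ℂ :=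
  ((g 0 0 : ℂ) * z + (g 0 1 : ℂ)) / ((g 1 0 : ℂ) * z + (g 1 1 : ℂ))

/-- The rotation matrix `k_θ ∈ SL(2,ℝ)`. -/
def kMat (θ : ℝ) : Matrix (Fin 2) (Fin 2) ℝ :=
  !![Real.cos θ, Real.sin θ; -Real.sin θ, Real.cos θ]

/-- The matrix `p_z = ((√y, x/√y), (0, 1/√y)) ∈ SL(2,ℝ)` for `z = x + iy`. -/
def pMat (x y : ℝ) : Matrix (Fin 2) (Fin 2) ℝ :=
  !![Real.sqrt y, x / Real.sqrt y; 0, 1 / Real.sqrt y]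

/-- The function `φ_r(z) = (Im z)^{ir + 1/2}`. -/
def phir (r : ℝ) (z : ℂ) : ℂ :=
  Complex.exp ((r * Complex.I + 1 / 2) * Complex.log (z.im))

/-- The generalized spherical function
`Φ_{r,n}(z) = (1/π) ∫_0^π φ_r(k_θ⁻¹ · z) e^{2inθ} dθ` (note `k_θ⁻¹ = k_{-θ}`). -/
def sphFn (r : ℝ) (n : ℤ) (z : ℂ) : ℂ :=
  (1 / Real.pi : ℂ) * ∫ θ in (0 : ℝ)..Real.pi,
    phir r (moebius (kMat (-θ)) z) * Complex.exp (2 * n * θ * Complex.I)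

/-- The hyperbolic measure `dμ = dx·dy/y²` on the upper half-plane, viewed as a
measure on ℂ supported on `{z : 0 < Im z}`. -/
def hypMeasure : Measure ℂ :=
  (volume.withDensity fun z => ENNReal.ofReal ((z.im)⁻¹ ^ 2)).restrict {z : ℂ | 0 < z.im}

/-- The `n`-spherical transform `𝒮_n f(r) = ∫_ℍ f(z)·Φ_{r,−n}(z) dμ(z)`. -/
def sphTransform (n : ℤ) (f : ℂ → ℂ) (r : ℝ) : ℂ :=
  ∫ z, f z * sphFn r (-n) z ∂hypMeasure

open scoped UpperHalfPlane MatrixGroups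

/-- The rotation `kMat θ` as an element of `SL(2, ℝ)`. -/
def kSL (θ : ℝ) : SL(2, ℝ) :=
  ⟨kMat θ, by
    have := Real.cos_sq_add_sin_sq θ
    simp only [kMat, Matrix.det_fin_two_of]
    linarith⟩

/-- The matrix `pMat x y` as an element of `SL(2, ℝ)`. -/
def pSL (x y : ℝ) (hy : 0 < y) : SL(2, ℝ) :=
  ⟨pMat x y, by
    have := (Real.sqrt_pos.2 hy).ne'
    simp [pMat, this]⟩

lemma kSL_neg (θ : ℝ) : kSL (-θ) = (kSL θ)⁻¹ := by
  apply Subtype.ext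
  rw [Matrix.SpecialLinearGroup.coe_inv]
  simp [kSL, kMat, Matrix.adjugate_fin_two]

lemma moebius_coe (g : SL(2, ℝ)) (z : ℍ) : moebius g z = ((g • z : ℍ) : ℂ) := by
  rw [UpperHalfPlane.coe_specialLinearGroup_apply]
  rfl

lemma inv_pMat_mul_kMat (x y α : ℝ) (hy : 0 < y) :
    (pMat x y * kMat α)⁻¹ = ((pSL x y hy * kSL α)⁻¹ : SL(2, ℝ)) := by
  rw [Matrix.SpecialLinearGroup.coe_inv]
  change ((pSL x y hy * kSL α : SL(2, ℝ)) : Matrix (Fin 2) (Fin 2) ℝ)⁻¹ = _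
  simp [Matrix.inv_def, -Matrix.SpecialLinearGroup.coe_mul]

lemma hypMeasure_eq_map :
    hypMeasure = Measure.map UpperHalfPlane.coe (volume : Measure ℍ) := by
  ext s hs
  have hU : MeasurableSet {z : ℂ | 0 < z.im} := measurableSet_lt measurable_const measurable_im
  rw [UpperHalfPlane.measurableEmbedding_coe.map_apply, UpperHalfPlane.volume_eq_lintegral,
    hypMeasure, Measure.restrict_apply hs, withDensity_apply _ (hs.inter hU),
    Set.image_preimage_eq_inter_range, UpperHalfPlane.range_coe]
  refine setLIntegral_congr_fun (hs.inter hU) fun z hz => ?_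
  have hz' : 0 < z.im := hz.2
  rw [ENNReal.ofReal, ENNReal.coe_inj]
  ext
  simp [sq_nonneg]

lemma integral_hypMeasure (F : ℂ → ℂ) : ∫ w, F w ∂hypMeasure = ∫ z : ℍ, F z := by
  rw [hypMeasure_eq_map, UpperHalfPlane.measurableEmbedding_coe.integral_map]

lemma integral_sl_smul (g : SL(2, ℝ)) (F : ℍ → ℂ) : ∫ z, F (g • z) = ∫ z, F z :=
  integral_smul_eq_self F (g := Matrix.SpecialLinearGroup.mapGL ℝ g)

lemma phir_pSL_smul (r x y : ℝ) (hy : 0 < y) (z : ℍ) :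
    phir r (pSL x y hy • z : ℍ) = exp ((r * I + 1 / 2) * log (y : ℂ)) * phir r z := by
  have hs : (√y : ℂ) ≠ 0 := by exact_mod_cast (Real.sqrt_pos.2 hy).ne'
  have him : ((pSL x y hy • z : ℍ) : ℂ).im = y * (z : ℂ).im := by
    have h : ((pSL x y hy • z : ℍ) : ℂ) = y * z + x := by
      rw [← moebius_coe]
      have hsq : (√y : ℂ) ^ 2 = y := by exact_mod_cast Real.sq_sqrt hy.le
      simp only [moebius, pSL, pMat, Matrix.of_apply, Matrix.cons_val]
      push_cast
      field_simp
      rw [hsq]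
      ring
    simp [h]
  have hz : (z : ℂ).im ≠ 0 := z.im_ne_zero
  rw [phir, phir, him, ← exp_add, ofReal_mul, log_ofReal_mul hy (by exact_mod_cast hz),
    ofReal_log hy.le]
  ring_nf

lemma continuous_phir_rotation (r : ℝ) :
    Continuous fun q : ℍ × ℝ => phir r (kSL q.2 • q.1 : ℍ) := by
  have hc : Continuous fun q : ℍ × ℝ => ((kSL q.2 • q.1 : ℍ) : ℂ) := by
    simp only [UpperHalfPlane.coe_specialLinearGroup_apply]
    refine Continuous.div ?_ ?_ fun q => UpperHalfPlane.denom_ne_zero (kSL q.2) q.1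
    all_goals
      simp only [kSL, kMat, Matrix.of_apply, Matrix.cons_val, Algebra.algebraMap_self,
        RingHom.id_apply]
      fun_prop
  unfold phir
  refine continuous_exp.comp (continuous_const.mul ?_)
  refine Continuous.clog (continuous_ofReal.comp (continuous_im.comp hc)) fun q => ?_
  exact Or.inl (kSL q.2 • q.1).im_pos

lemma isCompact_preimage_coe_tsupport {f : ℂ → ℂ} (hsupp : HasCompactSupport f)
    (hsuppH : tsupport f ⊆ {z : ℂ | 0 < z.im}) :
    IsCompact (UpperHalfPlane.coe ⁻¹' tsupport f) := by
  refine (UpperHalfPlane.isOpenEmbedding_coe.isInducing.isCompact_preimage_iff ?_).2 hsupp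
  rwa [UpperHalfPlane.range_coe]

/-- The integral of `f` against the spherical function unfolds, by Fubini and invariance of the
measure, to the integral against `phir r`. -/
lemma sphTransform_eq_integral (n : ℤ) (f : ℂ → ℂ) (hf : Continuous f)
    (hsupp : HasCompactSupport f) (hsuppH : tsupport f ⊆ {z : ℂ | 0 < z.im})
    (hequi : ∀ θ : ℝ, ∀ z : ℍ, f (kSL θ • z : ℍ) = exp (2 * n * θ * I) * f z) (r : ℝ) :
    sphTransform n f r = ∫ z : ℍ, f z * phir r z := by
  set G : ℝ → ℍ → ℂ := fun θ z =>
    f z * (phir r (kSL (-θ) • z : ℍ) * exp (2 * (-n : ℤ) * θ * I)) with hG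
  have hcont : Continuous (Function.uncurry G) := by
    have h := (continuous_phir_rotation r).comp
      (continuous_snd.prodMk continuous_fst.neg : Continuous fun q : ℝ × ℍ => (q.2, -q.1))
    have h' : Continuous fun q : ℝ × ℍ => f q.2 :=
      hf.comp (UpperHalfPlane.continuous_coe.comp continuous_snd)
    refine h'.mul (h.mul ?_)
    fun_prop
  have hint : Integrable (Function.uncurry G)
      ((volume.restrict (Set.uIoc 0 Real.pi)).prod volume) := by
    rw [← Measure.restrict_univ (μ := (volume : Measure ℍ)), Measure.prod_restrict]
    have hK := (isCompact_uIcc (a := 0) (b := Real.pi)).prod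
      (isCompact_preimage_coe_tsupport hsupp hsuppH)
    refine IntegrableOn.of_forall_sdiff_eq_zero
      (hcont.continuousOn.integrableOn_compact hK |>.mono_set
        (Set.prod_mono Set.uIoc_subset_uIcc subset_rfl) :
        IntegrableOn _ (Set.uIoc 0 Real.pi ×ˢ (UpperHalfPlane.coe ⁻¹' tsupport f)) _)
      (measurableSet_uIoc.prod MeasurableSet.univ) ?_
    rintro ⟨θ, z⟩ ⟨⟨hθ, -⟩, hz⟩
    have : f z = 0 := image_eq_zero_of_notMem_tsupport fun h => hz ⟨hθ, h⟩
    simp [hG, this]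
  have hinner (θ : ℝ) : ∫ z, G θ z = ∫ z : ℍ, f z * phir r z := by
    rw [← integral_sl_smul (kSL θ)]
    refine integral_congr_ae (.of_forall fun z => ?_)
    have he : exp (2 * n * θ * I) * exp (2 * (-n : ℤ) * θ * I) = 1 := by
      rw [← exp_add, exp_eq_one_iff]
      exact ⟨0, by push_cast; ring⟩
    simp only [hG, hequi, kSL_neg, inv_smul_smul]
    linear_combination (f z * phir r z) * he
  have hpi : (Real.pi : ℂ) ≠ 0 := by exact_mod_cast Real.pi_ne_zero
  calc sphTransform n f r
      = ∫ z : ℍ, (1 / Real.pi : ℂ) * ∫ θ in (0 : ℝ)..Real.pi, G θ z := by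
        rw [sphTransform, integral_hypMeasure]
        refine integral_congr_ae (.of_forall fun z => ?_)
        simp only [hG, sphFn, intervalIntegral.integral_const_mul, ← moebius_coe]
        rw [mul_left_comm]
        rfl
    _ = (1 / Real.pi : ℂ) * ∫ θ in (0 : ℝ)..Real.pi, ∫ z, G θ z := by
        rw [integral_const_mul, intervalIntegral_integral_swap hint]
    _ = ∫ z : ℍ, f z * phir r z := by
        simp only [hinner, intervalIntegral.integral_const, sub_zero, real_smul]
        field_simp

/-- For `f` continuous, compactly supported in ℍ and `K`-equivariant of weight `n`,
the convolution operator `L[f]` applied to `φ_r` satisfies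
`∫_ℍ f((p_z k_α)⁻¹·w)·φ_r(w) dμ(w) = 𝒮_n f(r)·e^{−2inα}·(Im z)^{ir+1/2}`. -/
theorem convolution_eigenfunction (n : ℤ) (f : ℂ → ℂ) (hf : Continuous f)
    (hsupp : HasCompactSupport f) (hsuppH : tsupport f ⊆ {z : ℂ | 0 < z.im})
    (hequi : ∀ θ : ℝ, ∀ z : ℂ, 0 < z.im →
      f (moebius (kMat θ) z) = Complex.exp (2 * n * θ * Complex.I) * f z) :
    ∀ r : ℝ, ∀ x y α : ℝ, 0 < y →
      ∫ w, f (moebius ((pMat x y * kMat α)⁻¹) w) * phir r w ∂hypMeasure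
        = sphTransform n f r * Complex.exp (-(2 * n * α) * Complex.I) *
            Complex.exp ((r * Complex.I + 1 / 2) * Complex.log (y : ℂ)) := by
  intro r x y α hy
  have hequi' (θ : ℝ) (z : ℍ) : f (kSL θ • z : ℍ) = exp (2 * n * θ * I) * f z := by
    rw [← moebius_coe]
    exact hequi θ z z.im_pos
  rw [sphTransform_eq_integral n f hf hsupp hsuppH hequi', integral_hypMeasure,
    inv_pMat_mul_kMat x y α hy, ← integral_sl_smul (pSL x y hy), mul_assoc,
    ← integral_mul_const]
  refine integral_congr_ae (.of_forall fun z => ?_)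
  have hexp : exp (2 * n * (-α : ℝ) * I) = exp (-(2 * n * α) * I) := by
    push_cast
    ring_nf
  simp only [moebius_coe, phir_pSL_smul, mul_inv_rev, mul_smul, inv_smul_smul, ← kSL_neg, hequi',
    hexp]
  ring

end
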